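/- Let 0 < α < 1, a < b, let L : [a,b] × ℝⁿ × ℝⁿ → ℝ be of class C², and let q : [a,b] → ℝⁿ be of class C². Suppose q is a stationary function of the fractional functional I[q] = ∫_a^b L(t, q(t), (ᴿᶜDᵅ q)(t)) dt, in the sense that for every η : [a,b] → ℝⁿ of class C² with η(a) = η(b) = 0, the map ε ↦ ∫_a^b L(t, q(t)+εη(t), (ᴿᶜDᵅ(q+εη))(t)) dt is differentiable at ε = 0 with derivative 0. Assume moreover that the function t ↦ ∂₃L(t, q(t), (ᴿᶜDᵅ q)(t)) admits a Riesz fractional derivative of order α at every t ∈ [a,b]. Then q satisfies the fractional Euler–Lagrange equation in the sense of Riesz–Caputo: ∂₂L(t, q(t), (ᴿᶜDᵅ q)(t)) − (ᴿDᵅ [s ↦ ∂₃L(s, q(s), (ᴿᶜDᵅ q)(s))])(t) = 0 for all t ∈ [a,b]. -/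

import Mathlib

open Real Set MeasureTheory intervalIntegral
open scoped RealInnerProductSpace

/-- Riesz-type kernel integral of `g` on `[a,b]`:
`(1/(2Γ(1-α))) ∫_a^b |s-θ|^{-α} g(θ) dθ`. -/
noncomputable def rieszInt {E : Type*} [NormedAddCommGroup E] [NormedSpace ℝ E]
    (α a b : ℝ) (g : ℝ → E) (s : ℝ) : E :=
  (1 / (2 * Real.Gamma (1 - α))) • ∫ θ in a..b, |s - θ| ^ (-α) • g θ

/-- Riesz–Caputo fractional derivative of order `α` (for `0 < α < 1`) of `f` on `[a,b]`:
`(1/(2Γ(1-α))) ∫_a^b |t-θ|^{-α} f'(θ) dθ`. -/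
noncomputable def RCDeriv {E : Type*} [NormedAddCommGroup E] [NormedSpace ℝ E]
    (α a b : ℝ) (f : ℝ → E) (t : ℝ) : E :=
  rieszInt α a b (fun θ => derivWithin f (Set.Icc a b) θ) t

/-- Riesz fractional derivative of order `α` (for `0 < α < 1`) of `g` on `[a,b]`:
`d/dt [(1/(2Γ(1-α))) ∫_a^b |t-θ|^{-α} g(θ) dθ]`. -/
noncomputable def RDeriv {E : Type*} [NormedAddCommGroup E] [NormedSpace ℝ E]
    (α a b : ℝ) (g : ℝ → E) (t : ℝ) : E :=
  deriv (rieszInt α a b g) t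

section ContinuousExtension

variable {E : Type*} [NormedAddCommGroup E] {a b : ℝ} {f : ℝ → E}

lemma ContinuousOn.exists_continuous_eqOn_Icc (hab : a ≤ b) (hf : ContinuousOn f (Icc a b)) :
    ∃ F : ℝ → E, Continuous F ∧ EqOn F f (Icc a b) := by
  refine ⟨IccExtend hab ((Icc a b).domRestrict f),
    (continuousOn_iff_continuous_domRestrict.1 hf).Icc_extend', fun x hx => ?_⟩
  rw [IccExtend_of_mem hab _ hx]
  rfl

end ContinuousExtension

section RieszIntegral

variable {E : Type*} [NormedAddCommGroup E] [NormedSpace ℝ E] {α a b : ℝ}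

lemma intervalIntegrable_abs_rpow_neg (hα1 : α < 1) (c d : ℝ) :
    IntervalIntegrable (fun u : ℝ => |u| ^ (-α)) volume c d := by
  refine intervalIntegrable_of_even (fun x => by simp) (fun x hx => ?_)
  refine (intervalIntegrable_rpow' (by linarith : -1 < -α)).congr fun y hy => ?_
  rw [uIoc_of_le hx.le] at hy
  simp only [abs_of_pos hy.1]

/-- The Riesz kernel `|u|^{-α}`, cut off outside `[-R, R]`. -/
noncomputable def truncatedRieszKernel (α R : ℝ) : ℝ → ℝ :=
  (Icc (-R) R).indicator fun u => |u| ^ (-α)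

lemma integrable_truncatedRieszKernel (hα1 : α < 1) {R : ℝ} (hR : 0 ≤ R) :
    Integrable (truncatedRieszKernel α R) :=
  ((intervalIntegrable_iff_integrableOn_Icc_of_le (by linarith)).1
    (intervalIntegrable_abs_rpow_neg hα1 (-R) R)).integrable_indicator measurableSet_Icc

lemma truncatedRieszKernel_sub {s θ : ℝ} (hs : s ∈ Icc a b) (hθ : θ ∈ Icc a b) :
    truncatedRieszKernel α (b - a) (s - θ) = |s - θ| ^ (-α) := by
  refine indicator_of_mem (mem_Icc.2 ⟨?_, ?_⟩) _ <;> linarith [hs.1, hs.2, hθ.1, hθ.2]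

lemma rieszInt_congr (hab : a ≤ b) {f g : ℝ → E} (h : EqOn f g (Icc a b)) (s : ℝ) :
    rieszInt α a b f s = rieszInt α a b g s := by
  unfold rieszInt
  congr 1
  refine intervalIntegral.integral_congr fun θ hθ => ?_
  rw [uIcc_of_le hab] at hθ
  simp only [h hθ]

lemma rieszInt_eq_integral_truncatedRieszKernel (hab : a ≤ b) (f : ℝ → E) {s : ℝ}
    (hs : s ∈ Icc a b) :
    rieszInt α a b f s = (1 / (2 * Real.Gamma (1 - α))) •
      ∫ u, truncatedRieszKernel α (b - a) u • (Ioc a b).indicator f (s - u) := by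
  unfold rieszInt
  congr 1
  rw [← integral_sub_left_eq_self _ volume s, intervalIntegral.integral_of_le hab,
    ← MeasureTheory.integral_indicator measurableSet_Ioc]
  congr 1
  ext θ
  by_cases hθ : θ ∈ Ioc a b
  · simp [hθ, truncatedRieszKernel_sub hs (Ioc_subset_Icc_self hθ)]
  · simp [hθ]

lemma continuous_integral_smul_indicator_sub {κ : ℝ → ℝ} (hκ : Integrable κ) {f : ℝ → E}
    (hf : Continuous f) : Continuous fun s => ∫ u, κ u • (Ioc a b).indicator f (s - u) := by
  obtain ⟨C, hC⟩ := isCompact_Icc.exists_bound_of_continuousOn (hf.continuousOn (s := Icc a b))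
  have hbound : ∀ x, ‖(Ioc a b).indicator f x‖ ≤ max C 0 := fun x => by
    by_cases hx : x ∈ Ioc a b
    · simpa [hx] using Or.inl (hC x (Ioc_subset_Icc_self hx))
    · simp [hx]
  have hmeas : StronglyMeasurable ((Ioc a b).indicator f) :=
    hf.stronglyMeasurable.indicator measurableSet_Ioc
  refine continuous_iff_continuousAt.2 fun s => ?_
  refine MeasureTheory.continuousAt_of_dominated (bound := fun u => ‖κ u‖ * max C 0)
    (Filter.Eventually.of_forall fun x => hκ.1.smul
      (hmeas.comp_measurable (measurable_const.sub measurable_id)).aestronglyMeasurable)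
    (Filter.Eventually.of_forall fun x => Filter.Eventually.of_forall fun u => ?_)
    (hκ.norm.mul_const _) ?_
  · rw [norm_smul]
    gcongr
    exact hbound _
  · have : ∀ᵐ u : ℝ, u ∉ ({s - a, s - b} : Set ℝ) :=
      compl_mem_ae_iff.2 (Set.Finite.measure_zero (by simp) _)
    filter_upwards [this] with u hu
    refine continuousAt_const.smul ?_
    refine ContinuousAt.comp (f := fun x => x - u) (g := (Ioc a b).indicator f) ?_ (by fun_prop)
    refine hf.continuousOn.continuousAt_indicator fun h => hu ?_
    by_cases hab : a < b
    · rw [frontier_Ioc hab] at h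
      rcases h with h | h
      · left; linarith
      · right; rw [mem_singleton_iff] at h ⊢; linarith
    · simp [Ioc_eq_empty hab] at h

lemma continuousOn_rieszInt (hα1 : α < 1) (hab : a ≤ b) {f : ℝ → E}
    (hf : ContinuousOn f (Icc a b)) : ContinuousOn (rieszInt α a b f) (Icc a b) := by
  obtain ⟨F, hF, hFf⟩ := hf.exists_continuous_eqOn_Icc hab
  refine ContinuousOn.congr (((continuous_integral_smul_indicator_sub (a := a) (b := b)
    (integrable_truncatedRieszKernel hα1 (sub_nonneg.2 hab)) hF).const_smul
      (1 / (2 * Real.Gamma (1 - α)))).continuousOn) fun s hs => ?_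
  rw [← rieszInt_congr hab hFf, rieszInt_eq_integral_truncatedRieszKernel hab F hs]
  rfl

lemma intervalIntegrable_abs_sub_rpow_smul (hα1 : α < 1) (hab : a ≤ b) {f : ℝ → E}
    (hf : ContinuousOn f (Icc a b)) (s : ℝ) :
    IntervalIntegrable (fun θ => |s - θ| ^ (-α) • f θ) volume a b := by
  rw [← uIcc_of_le hab] at hf
  have h := (intervalIntegrable_abs_rpow_neg hα1 (s - a) (s - b)).comp_sub_left s
  simp only [sub_sub_cancel] at h
  exact h.smul_continuousOn hf

lemma rieszInt_add_smul (hα1 : α < 1) (hab : a ≤ b) {f g : ℝ → E}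
    (hf : ContinuousOn f (Icc a b)) (hg : ContinuousOn g (Icc a b)) (ε s : ℝ) :
    rieszInt α a b (fun θ => f θ + ε • g θ) s
      = rieszInt α a b f s + ε • rieszInt α a b g s := by
  have hgi : IntervalIntegrable (fun θ => ε • |s - θ| ^ (-α) • g θ) volume a b :=
    (intervalIntegrable_abs_sub_rpow_smul hα1 hab hg s).smul ε
  unfold rieszInt
  rw [smul_comm ε, ← smul_add, ← intervalIntegral.integral_smul ε,
    ← intervalIntegral.integral_add (intervalIntegrable_abs_sub_rpow_smul hα1 hab hf s) hgi]
  simp only [smul_add, smul_comm ε]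

lemma RCDeriv_add_smul (hα1 : α < 1) (hab : a < b) {f g : ℝ → E}
    (hf : ContDiffOn ℝ 1 f (Icc a b)) (hg : ContDiffOn ℝ 1 g (Icc a b)) (ε s : ℝ) :
    RCDeriv α a b (fun θ => f θ + ε • g θ) s
      = RCDeriv α a b f s + ε • RCDeriv α a b g s := by
  have hu := uniqueDiffOn_Icc hab
  unfold RCDeriv
  rw [← rieszInt_add_smul hα1 hab.le (hf.continuousOn_derivWithin hu le_rfl)
    (hg.continuousOn_derivWithin hu le_rfl)]
  refine rieszInt_congr hab.le (fun θ hθ => ?_) s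
  exact (((hf.differentiableOn one_ne_zero θ hθ).hasDerivWithinAt).add
    (((hg.differentiableOn one_ne_zero θ hθ).hasDerivWithinAt).const_smul ε)).derivWithin (hu θ hθ)

end RieszIntegral

section RieszIntegralInner

variable {E : Type*} [NormedAddCommGroup E] [InnerProductSpace ℝ E] [CompleteSpace E] {α a b : ℝ}

lemma integrable_abs_sub_rpow_mul_prod (hα1 : α < 1) (hab : a ≤ b) {φ : ℝ × ℝ → ℝ}
    (hφ : Continuous φ) :
    Integrable (fun p : ℝ × ℝ => |p.1 - p.2| ^ (-α) * φ p)
      ((volume.restrict (Ioc a b)).prod (volume.restrict (Ioc a b))) := by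
  rw [Measure.prod_restrict]
  have h1 : Integrable ((Ioc a b).indicator fun _ : ℝ => (1 : ℝ)) :=
    (integrableOn_const (by simp)).integrable_indicator measurableSet_Ioc
  have h2 := Integrable.convolution_integrand (ContinuousLinearMap.mul ℝ ℝ) h1
    (integrable_truncatedRieszKernel hα1 (sub_nonneg.2 hab))
  obtain ⟨C, hC⟩ := (isCompact_Icc.prod isCompact_Icc).exists_bound_of_continuousOn
    (hφ.continuousOn (s := Icc a b ×ˢ Icc a b))
  have hm : MeasurableSet (Ioc a b ×ˢ Ioc a b) := measurableSet_Ioc.prod measurableSet_Ioc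
  have h3 := (h2.restrict (s := Ioc a b ×ˢ Ioc a b)).mul_bdd (g := φ) (c := C)
    hφ.aestronglyMeasurable ((ae_restrict_mem hm).mono fun p hp =>
      hC p ⟨Ioc_subset_Icc_self hp.1, Ioc_subset_Icc_self hp.2⟩)
  refine h3.congr ((ae_restrict_mem hm).mono fun p hp => ?_)
  simp [indicator_of_mem hp.2, truncatedRieszKernel_sub (Ioc_subset_Icc_self hp.1)
    (Ioc_subset_Icc_self hp.2)]

/-- The Riesz integral is symmetric with respect to the `L²` inner product. -/
lemma integral_inner_rieszInt (hα1 : α < 1) (hab : a ≤ b) {g h : ℝ → E}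
    (hg : ContinuousOn g (Icc a b)) (hh : ContinuousOn h (Icc a b)) :
    ∫ t in a..b, ⟪g t, rieszInt α a b h t⟫ = ∫ t in a..b, ⟪rieszInt α a b g t, h t⟫ := by
  have key : ∀ {g h : ℝ → E}, ContinuousOn h (Icc a b) → ∀ t,
      ⟪g t, rieszInt α a b h t⟫ = (1 / (2 * Real.Gamma (1 - α))) *
        ∫ θ in Ioc a b, |t - θ| ^ (-α) * ⟪g t, h θ⟫ := fun {g h} hh t => by
    unfold rieszInt
    rw [inner_smul_right, intervalIntegral.integral_of_le hab, ← integral_inner]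
    · simp only [inner_smul_right]
    · exact (intervalIntegrable_iff_integrableOn_Ioc_of_le hab).1
        (intervalIntegrable_abs_sub_rpow_smul hα1 hab hh t)
  obtain ⟨G, hG, hGg⟩ := hg.exists_continuous_eqOn_Icc hab
  obtain ⟨H, hH, hHh⟩ := hh.exists_continuous_eqOn_Icc hab
  have hswap := integral_integral_swap
    (f := fun t θ : ℝ => |t - θ| ^ (-α) * ⟪G t, H θ⟫)
    (integrable_abs_sub_rpow_mul_prod hα1 hab (φ := fun p => ⟪G p.1, H p.2⟫)
      (by fun_prop))
  have e1 : ∀ t ∈ uIcc a b, ⟪g t, rieszInt α a b h t⟫ = ⟪G t, rieszInt α a b H t⟫ := by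
    intro t ht
    rw [uIcc_of_le hab] at ht
    rw [hGg ht, rieszInt_congr hab hHh]
  have e2 : ∀ t ∈ uIcc a b, ⟪rieszInt α a b g t, h t⟫ = ⟪H t, rieszInt α a b G t⟫ := by
    intro t ht
    rw [uIcc_of_le hab] at ht
    rw [hHh ht, rieszInt_congr hab hGg, real_inner_comm]
  rw [intervalIntegral.integral_congr e1, intervalIntegral.integral_congr e2]
  simp only [key hH.continuousOn, key hG.continuousOn, intervalIntegral.integral_of_le hab,
    MeasureTheory.integral_const_mul]
  rw [hswap]
  simp only [real_inner_comm, abs_sub_comm]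

end RieszIntegralInner

section PartialGradients

variable {V : Type*} [NormedAddCommGroup V] [InnerProductSpace ℝ V] [CompleteSpace V]
  {L : ℝ → V → V → ℝ}

lemma gradient_snd_eq (hL : Differentiable ℝ fun x : ℝ × V × V => L x.1 x.2.1 x.2.2) (t : ℝ)
    (x u : V) :
    gradient (fun y => L t y u) x = (InnerProductSpace.toDual ℝ V).symm
      ((fderiv ℝ (fun x : ℝ × V × V => L x.1 x.2.1 x.2.2) (t, x, u)).comp
        ((ContinuousLinearMap.inr ℝ ℝ (V × V)).comp (ContinuousLinearMap.inl ℝ V V))) := by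
  refine HasGradientAt.gradient (hasGradientAt_iff_hasFDerivAt.2 ?_)
  rw [LinearIsometryEquiv.apply_symm_apply]
  have hmk : HasFDerivAt (fun y => (t, y, u))
      ((ContinuousLinearMap.inr ℝ ℝ (V × V)).comp (ContinuousLinearMap.inl ℝ V V)) x :=
    (hasFDerivAt_prodMk_right t (x, u)).comp x (hasFDerivAt_prodMk_left x u)
  exact HasFDerivAt.comp x (hL (t, x, u)).hasFDerivAt hmk

lemma gradient_thd_eq (hL : Differentiable ℝ fun x : ℝ × V × V => L x.1 x.2.1 x.2.2) (t : ℝ)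
    (x u : V) :
    gradient (fun v => L t x v) u = (InnerProductSpace.toDual ℝ V).symm
      ((fderiv ℝ (fun x : ℝ × V × V => L x.1 x.2.1 x.2.2) (t, x, u)).comp
        ((ContinuousLinearMap.inr ℝ ℝ (V × V)).comp (ContinuousLinearMap.inr ℝ V V))) := by
  refine HasGradientAt.gradient (hasGradientAt_iff_hasFDerivAt.2 ?_)
  rw [LinearIsometryEquiv.apply_symm_apply]
  have hmk : HasFDerivAt (fun y => (t, x, y))
      ((ContinuousLinearMap.inr ℝ ℝ (V × V)).comp (ContinuousLinearMap.inr ℝ V V)) u :=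
    (hasFDerivAt_prodMk_right t (x, u)).comp u (hasFDerivAt_prodMk_right x u)
  exact HasFDerivAt.comp u (hL (t, x, u)).hasFDerivAt hmk

lemma fderiv_eq_inner_gradient (hL : Differentiable ℝ fun x : ℝ × V × V => L x.1 x.2.1 x.2.2)
    (t : ℝ) (x u v w : V) :
    fderiv ℝ (fun x : ℝ × V × V => L x.1 x.2.1 x.2.2) (t, x, u) (0, v, w)
      = ⟪gradient (fun y => L t y u) x, v⟫ + ⟪gradient (fun y => L t x y) u, w⟫ := by
  rw [gradient_snd_eq hL, gradient_thd_eq hL, InnerProductSpace.toDual_symm_apply,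
    InnerProductSpace.toDual_symm_apply]
  simp [← map_add]

lemma continuousOn_gradient_snd (hL : ContDiff ℝ 1 fun x : ℝ × V × V => L x.1 x.2.1 x.2.2)
    {q u : ℝ → V} {s : Set ℝ} (hq : ContinuousOn q s) (hu : ContinuousOn u s) :
    ContinuousOn (fun t => gradient (fun y => L t y (u t)) (q t)) s := by
  simp only [gradient_snd_eq (hL.differentiable one_ne_zero)]
  exact (LinearIsometryEquiv.continuous _).comp_continuousOn
    (((hL.continuous_fderiv one_ne_zero).comp_continuousOn
      (continuousOn_id.prodMk (hq.prodMk hu))).clm_comp continuousOn_const)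

lemma continuousOn_gradient_thd (hL : ContDiff ℝ 1 fun x : ℝ × V × V => L x.1 x.2.1 x.2.2)
    {q u : ℝ → V} {s : Set ℝ} (hq : ContinuousOn q s) (hu : ContinuousOn u s) :
    ContinuousOn (fun t => gradient (fun y => L t (q t) y) (u t)) s := by
  simp only [gradient_thd_eq (hL.differentiable one_ne_zero)]
  exact (LinearIsometryEquiv.continuous _).comp_continuousOn
    (((hL.continuous_fderiv one_ne_zero).comp_continuousOn
      (continuousOn_id.prodMk (hq.prodMk hu))).clm_comp continuousOn_const)

end PartialGradients

section FirstVariation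

variable {V : Type*} [NormedAddCommGroup V] [NormedSpace ℝ V] {a b : ℝ}

lemma hasDerivAt_integral_perturbation {Λ : ℝ × V × V → ℝ} (hΛ : ContDiff ℝ 1 Λ)
    {q u η w : ℝ → V} (hq : Continuous q) (hu : Continuous u) (hη : Continuous η)
    (hw : Continuous w) :
    HasDerivAt (fun ε : ℝ => ∫ t in a..b, Λ (t, q t + ε • η t, u t + ε • w t))
      (∫ t in a..b, fderiv ℝ Λ (t, q t, u t) (0, η t, w t)) 0 := by
  have hF' : Continuous fun p : ℝ × ℝ =>
      fderiv ℝ Λ (p.2, q p.2 + p.1 • η p.2, u p.2 + p.1 • w p.2) (0, η p.2, w p.2) :=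
    ((hΛ.continuous_fderiv one_ne_zero).comp (by fun_prop)).clm_apply (by fun_prop)
  have hΛc := hΛ.continuous
  obtain ⟨C, hC⟩ := ((isCompact_closedBall (0 : ℝ) 1).prod (isCompact_uIcc (a := a) (b := b))
    ).exists_bound_of_continuousOn hF'.continuousOn
  have h := (intervalIntegral.hasDerivAt_integral_of_dominated_loc_of_deriv_le (μ := volume)
    (a := a) (b := b) (x₀ := (0 : ℝ)) (bound := fun _ => C)
    (F := fun ε t => Λ (t, q t + ε • η t, u t + ε • w t))
    (F' := fun ε t => fderiv ℝ Λ (t, q t + ε • η t, u t + ε • w t) (0, η t, w t))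
    (Metric.closedBall_mem_nhds 0 one_pos)
    (Filter.Eventually.of_forall fun ε =>
      Continuous.aestronglyMeasurable (by fun_prop))
    (Continuous.intervalIntegrable (by fun_prop) _ _)
    (hF'.comp (by fun_prop : Continuous fun t : ℝ => ((0 : ℝ), t))).aestronglyMeasurable
    (Filter.Eventually.of_forall fun t ht ε hε => hC (ε, t) ⟨hε, uIoc_subset_uIcc ht⟩)
    intervalIntegrable_const
    (Filter.Eventually.of_forall fun t _ ε _ => ?_)).2
  · simpa using h
  · have hline : ∀ x y : V, HasDerivAt (fun ε : ℝ => x + ε • y) y ε := fun x y => by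
      simpa using ((hasDerivAt_id ε).smul_const y).const_add x
    exact ((hΛ.differentiable one_ne_zero _).hasFDerivAt.comp_hasDerivAt ε
      ((hasDerivAt_const ε t).prodMk ((hline (q t) (η t)).prodMk (hline (u t) (w t)))))

end FirstVariation

section DuBoisReymond

variable {V : Type*} [NormedAddCommGroup V] {a b : ℝ}

/-- The du Bois-Reymond lemma. -/
lemma eqOn_const_of_integral_deriv_smul_eq_zero [NormedSpace ℝ V] [CompleteSpace V] (hab : a < b)
    {f : ℝ → V} (hf : ContinuousOn f (Icc a b))
    (h : ∀ ψ : ℝ → ℝ, ContDiff ℝ 2 ψ → ψ a = 0 → ψ b = 0 →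
      ∫ t in a..b, deriv ψ t • f t = 0) :
    ∃ c, EqOn f (fun _ => c) (Icc a b) := by
  have hab' : b - a ≠ 0 := (sub_pos.2 hab).ne'
  have hfi : IntervalIntegrable f volume a b := by
    rw [← uIcc_of_le hab.le] at hf
    exact hf.intervalIntegrable
  set c := (b - a)⁻¹ • ∫ t in a..b, f t with hc
  refine ⟨c, ?_⟩
  have hfc : ContinuousOn (fun t => f t - c) (Icc a b) := hf.sub continuousOn_const
  have hae : ∀ᵐ x, x ∈ Ioo a b → f x - c = 0 := by
    refine isOpen_Ioo.ae_eq_zero_of_integral_contDiff_smul_eq_zero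
      ((hfc.mono Ioo_subset_Icc_self).locallyIntegrableOn measurableSet_Ioo) fun g hg _ hgs => ?_
    have hgc := hg.continuous
    set m := (b - a)⁻¹ * ∫ t in a..b, g t with hm
    have hψd : ∀ x, HasDerivAt (fun x => ∫ t in a..x, (g t - m)) (g x - m) x := fun x =>
      (Continuous.integral_hasStrictDerivAt (by fun_prop) a x).hasDerivAt
    have hψd' : deriv (fun x => ∫ t in a..x, (g t - m)) = fun x => g x - m :=
      funext fun x => (hψd x).deriv
    have hzero := h (fun x => ∫ t in a..x, (g t - m))
      ((contDiff_succ_iff_deriv (n := 1)).2 ⟨fun x => (hψd x).differentiableAt, by simp, by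
        rw [hψd']
        exact (hg.of_le (by exact_mod_cast le_top)).sub contDiff_const⟩)
      (by simp)
      (by
        rw [intervalIntegral.integral_sub (hgc.intervalIntegrable _ _) intervalIntegrable_const,
          intervalIntegral.integral_const, hm, smul_eq_mul]
        field_simp
        ring)
    have hgf : IntervalIntegrable (fun t => g t • f t) volume a b :=
      hfi.continuousOn_smul hgc.continuousOn
    have hmf : IntervalIntegrable (fun t => m • f t) volume a b := hfi.smul m
    simp only [hψd', sub_smul] at hzero
    rw [intervalIntegral.integral_sub hgf hmf, intervalIntegral.integral_smul,
      sub_eq_zero] at hzero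
    rw [← setIntegral_eq_integral_of_forall_compl_eq_zero (s := Ioc a b),
      ← intervalIntegral.integral_of_le hab.le]
    · simp only [smul_sub]
      rw [intervalIntegral.integral_sub hgf
        (Continuous.intervalIntegrable (by fun_prop) _ _), hzero,
        intervalIntegral.integral_smul_const, hc, hm, smul_smul, mul_comm, sub_self]
    · intro x hx
      rw [image_eq_zero_of_notMem_tsupport (fun hx' => hx (Ioo_subset_Ioc_self (hgs hx'))),
        zero_smul]
  refine Measure.eqOn_Icc_of_ae_eq volume hab.ne ?_ hf continuousOn_const
  rw [← restrict_Ioo_eq_restrict_Icc]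
  exact (ae_restrict_iff' measurableSet_Ioo).2 (hae.mono fun x hx h => sub_eq_zero.1 (hx h))

/-- The integrated form of the Euler–Lagrange equation: if `∫ ⟪F, η⟫ + ⟪G, deriv η⟫ = 0` for all
test functions `η`, then `F` is the derivative of `G`. -/
lemma hasDerivWithinAt_of_integral_inner_eq_zero [InnerProductSpace ℝ V] [CompleteSpace V]
    (hab : a < b) {F G : ℝ → V} (hF : ContinuousOn F (Icc a b)) (hG : ContinuousOn G (Icc a b))
    (h : ∀ η : ℝ → V, ContDiff ℝ 2 η → η a = 0 → η b = 0 →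
      ∫ t in a..b, (⟪F t, η t⟫ + ⟪G t, deriv η t⟫) = 0) {t : ℝ} (ht : t ∈ Icc a b) :
    HasDerivWithinAt G (F t) (Icc a b) t := by
  obtain ⟨F₀, hF₀, hFF⟩ := hF.exists_continuous_eqOn_Icc hab.le
  set Φ : ℝ → V := fun x => ∫ s in a..x, F₀ s with hΦ
  have hΦd : ∀ x, HasDerivAt Φ (F₀ x) x := fun x =>
    (hF₀.integral_hasStrictDerivAt a x).hasDerivAt
  have hΦc : Continuous Φ := continuous_iff_continuousAt.2 fun x => (hΦd x).continuousAt
  have hGu : ContinuousOn G (uIcc a b) := by rwa [uIcc_of_le hab.le]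
  obtain ⟨c, hc⟩ := eqOn_const_of_integral_deriv_smul_eq_zero hab (hG.sub hΦc.continuousOn)
    fun ψ hψ ha hb => by
      have hψd : Differentiable ℝ ψ := hψ.differentiable two_ne_zero
      have hψc : Continuous (deriv ψ) := hψ.continuous_deriv one_le_two
      have hi : IntervalIntegrable (fun t => ψ t • F₀ t + deriv ψ t • G t) volume a b :=
        ((hψ.continuous.smul hF₀).continuousOn.add
          (hψc.continuousOn.smul hGu)).intervalIntegrable
      have h1 : ∫ t in a..b, (ψ t • F₀ t + deriv ψ t • G t) = 0 := by
        refine ext_inner_left ℝ fun v => ?_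
        rw [inner_zero_right, intervalIntegral.integral_of_le hab.le, ← integral_inner
          ((intervalIntegrable_iff_integrableOn_Ioc_of_le hab.le).1 hi),
          ← intervalIntegral.integral_of_le hab.le,
          ← h (fun t => ψ t • v) (hψ.smul contDiff_const) (by simp [ha]) (by simp [hb])]
        refine intervalIntegral.integral_congr fun t ht => ?_
        rw [uIcc_of_le hab.le] at ht
        simp only [hFF ht, deriv_smul_const (hψd t), inner_add_right, inner_smul_right,
          real_inner_comm v]
      have h2 : ∫ t in a..b, (ψ t • F₀ t + deriv ψ t • Φ t) = 0 := by
        rw [intervalIntegral.integral_eq_sub_of_hasDerivAt (f := fun t => ψ t • Φ t)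
          (fun t _ => (hψd t).hasDerivAt.smul (hΦd t))
          (Continuous.intervalIntegrable (by fun_prop) _ _)]
        simp [ha, hb]
      rw [← sub_self (0 : V)]
      nth_rewrite 1 [← h1]
      rw [← h2, ← intervalIntegral.integral_sub hi
        (Continuous.intervalIntegrable (by fun_prop) _ _)]
      simp [smul_sub]
  have hGΦ : EqOn G (fun x => Φ x + c) (Icc a b) := fun x hx => by
    simpa [add_comm] using sub_eq_iff_eq_add.1 (hc hx)
  rw [← hFF ht]
  exact ((hΦd t).add_const c).hasDerivWithinAt.congr hGΦ (hGΦ ht)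

end DuBoisReymond

/-- (Fractional Euler–Lagrange equation in the sense of Riesz–Caputo.)
If `q` is a stationary function of `I[q] = ∫_a^b L(t,q(t),(ᴿᶜDᵅq)(t)) dt` and
`t ↦ ∂₃L(t,q(t),(ᴿᶜDᵅq)(t))` admits a Riesz fractional derivative of order `α`
everywhere on `[a,b]`, then
`∂₂L(t,q(t),(ᴿᶜDᵅq)(t)) - ᴿDᵅ[s ↦ ∂₃L(s,q(s),(ᴿᶜDᵅq)(s))](t) = 0` on `[a,b]`. -/
theorem fractional_eulerLagrange_rieszCaputo
    {n : ℕ} (α a b : ℝ) (hα0 : 0 < α) (hα1 : α < 1) (hab : a < b)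
    (L : ℝ → EuclideanSpace ℝ (Fin n) → EuclideanSpace ℝ (Fin n) → ℝ)
    (hL : ContDiff ℝ 2 (fun x : ℝ × EuclideanSpace ℝ (Fin n) × EuclideanSpace ℝ (Fin n) =>
      L x.1 x.2.1 x.2.2))
    (q : ℝ → EuclideanSpace ℝ (Fin n)) (hq : ContDiffOn ℝ 2 q (Set.Icc a b))
    -- `q` is a stationary function of the fractional functional:
    (hstat : ∀ η : ℝ → EuclideanSpace ℝ (Fin n), ContDiffOn ℝ 2 η (Set.Icc a b) →
      η a = 0 → η b = 0 →
      HasDerivAt (fun ε : ℝ => ∫ t in a..b,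
          L t (q t + ε • η t) (RCDeriv α a b (fun s => q s + ε • η s) t)) 0 0)
    -- `t ↦ ∂₃L(t, q(t), (ᴿᶜDᵅq)(t))` admits a Riesz fractional derivative everywhere:
    (hRD : ∀ t ∈ Set.Icc a b, DifferentiableAt ℝ
      (rieszInt α a b (fun s => gradient (fun v => L s (q s) v) (RCDeriv α a b q s))) t) :
    ∀ t ∈ Set.Icc a b,
      gradient (fun y => L t y (RCDeriv α a b q t)) (q t)
        - RDeriv α a b (fun s => gradient (fun v => L s (q s) v) (RCDeriv α a b q s)) t
        = 0 := by
  have hu := uniqueDiffOn_Icc hab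
  have hL1 := hL.of_le one_le_two
  have hq1 := hq.of_le one_le_two
  have hRC : ∀ {η : ℝ → EuclideanSpace ℝ (Fin n)}, ContDiffOn ℝ 1 η (Icc a b) →
      ContinuousOn (RCDeriv α a b η) (Icc a b) := fun hη =>
    continuousOn_rieszInt hα1 hab.le (hη.continuousOn_derivWithin hu le_rfl)
  have hF := continuousOn_gradient_snd hL1 hq.continuousOn (hRC hq1)
  have hg := continuousOn_gradient_thd hL1 hq.continuousOn (hRC hq1)
  intro t ht
  refine sub_eq_zero.2 ?_
  refine (hu t ht).eq_deriv (Icc a b) ?_ (hRD t ht).hasDerivAt.hasDerivWithinAt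
  refine hasDerivWithinAt_of_integral_inner_eq_zero hab hF (continuousOn_rieszInt hα1 hab.le hg)
    (fun η hη ha hb => ?_) ht
  have hη1 : ContDiffOn ℝ 1 η (Icc a b) := (hη.of_le one_le_two).contDiffOn
  have hηc : Continuous (deriv η) := hη.continuous_deriv one_le_two
  have hηRC : EqOn (RCDeriv α a b η) (rieszInt α a b (deriv η)) (Icc a b) := fun s _ =>
    rieszInt_congr hab.le (fun θ hθ =>
      (hη.differentiable two_ne_zero θ).derivWithin (hu θ hθ)) s
  obtain ⟨q₀, hq₀, hqq⟩ := hq.continuousOn.exists_continuous_eqOn_Icc hab.le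
  obtain ⟨u₀, hu₀, huu⟩ := (hRC hq1).exists_continuous_eqOn_Icc hab.le
  obtain ⟨w₀, hw₀, hww⟩ := (hRC hη1).exists_continuous_eqOn_Icc hab.le
  have hvar := hasDerivAt_integral_perturbation (a := a) (b := b) hL1 hq₀ hu₀ hη.continuous hw₀
  have hfun : (fun ε : ℝ => ∫ t in a..b,
      L t (q t + ε • η t) (RCDeriv α a b (fun s => q s + ε • η s) t))
      = fun ε : ℝ => ∫ t in a..b, L t (q₀ t + ε • η t) (u₀ t + ε • w₀ t) := by
    ext ε
    refine intervalIntegral.integral_congr fun s hs => ?_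
    rw [uIcc_of_le hab.le] at hs
    simp only [RCDeriv_add_smul hα1 hab hq1 hη1, hqq hs, huu hs, hww hs]
  have hzero := hvar.unique (hfun ▸ hstat η hη.contDiffOn ha hb)
  have hcongr : ∀ s ∈ uIcc a b,
      fderiv ℝ (fun x : ℝ × EuclideanSpace ℝ (Fin n) × EuclideanSpace ℝ (Fin n) =>
        L x.1 x.2.1 x.2.2) (s, q₀ s, u₀ s) (0, η s, w₀ s)
      = ⟪gradient (fun y => L s y (RCDeriv α a b q s)) (q s), η s⟫
        + ⟪gradient (fun v => L s (q s) v) (RCDeriv α a b q s),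
            rieszInt α a b (deriv η) s⟫ := fun s hs => by
    rw [uIcc_of_le hab.le] at hs
    rw [fderiv_eq_inner_gradient (hL1.differentiable one_ne_zero), hqq hs, huu hs, hww hs,
      hηRC hs]
  have hint : ∀ {f g : ℝ → EuclideanSpace ℝ (Fin n)}, ContinuousOn f (Icc a b) →
      ContinuousOn g (Icc a b) → IntervalIntegrable (fun s => ⟪f s, g s⟫) volume a b :=
    fun hf hg => ContinuousOn.intervalIntegrable (by
      rw [uIcc_of_le hab.le]
      exact hf.inner hg)
  rw [intervalIntegral.integral_congr hcongr, intervalIntegral.integral_add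
    (hint hF hη.continuous.continuousOn)
    (hint hg (continuousOn_rieszInt hα1 hab.le hηc.continuousOn)),
    integral_inner_rieszInt hα1 hab.le hg hηc.continuousOn] at hzero
  rw [intervalIntegral.integral_add (hint hF hη.continuous.continuousOn)
    (hint (continuousOn_rieszInt hα1 hab.le hg) hηc.continuousOn)]
  exact hzero
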